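/- arXiv:1909.05276 — 2 statements merged into one kernel-verified Lean document; each statement's English description precedes it below -/
import Mathlib

section
/- Let n ≥ 2 and let f : E^n → E^n be a function that is surjective or continuous. If there exist r, R > 0 that are both strongly preserved by f and such that r/R is irrational, then f is a surjective isometry, i.e. f is a bijection and d(f(x), f(y)) = d(x, y) for all x, y ∈ E^n. (This is the Euclidean-space instance of Theorem A; Euclidean space is complete with infinite convexity radius, so the radius restriction is vacuous.) -/
section Helpers

variable {E : Type*} [NormedAddCommGroup E] [InnerProductSpace ℝ E] [FiniteDimensional ℝ E]

/-- The sphere of centre `c` and radius `h` in the affine subspace `c + W`. -/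
def subSphere (W : Submodule ℝ E) (c : E) (h : ℝ) : Set E := {x | x - c ∈ W ∧ ‖x - c‖ = h}

lemma exists_norm_eq_of_finrank_pos (W : Submodule ℝ E) (hW : 1 ≤ Module.finrank ℝ W)
    (s : ℝ) (hs : 0 ≤ s) : ∃ e ∈ W, ‖e‖ = s := by
  have : Nontrivial W := Module.nontrivial_of_finrank_pos (R := ℝ) hW
  obtain ⟨e, he⟩ := exists_norm_eq W hs
  exact ⟨e, e.2, he⟩

lemma exists_perp (W : Submodule ℝ E) (hW : 2 ≤ Module.finrank ℝ W) (u : E) (hu : u ∈ W)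
    (s : ℝ) (hs : 0 ≤ s) : ∃ e ∈ W, inner ℝ u e = 0 ∧ ‖e‖ = s := by
  have h1 := Submodule.finrank_add_inf_finrank_orthogonal (𝕜 := ℝ) (K₁ := Submodule.span ℝ {u})
    (K₂ := W) (by simpa using hu)
  have h2 : Module.finrank ℝ (Submodule.span ℝ {u}) ≤ 1 := by
    simpa using finrank_span_le_card (R := ℝ) ({u} : Set E)
  obtain ⟨e, he, hs⟩ := exists_norm_eq_of_finrank_pos
    ((Submodule.span ℝ {u})ᗮ ⊓ W) (by omega) s hs
  exact ⟨e, he.2, Submodule.mem_orthogonal_singleton_iff_inner_right.1 he.1, hs⟩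

lemma subSphere_slice (W : Submodule ℝ E) (c : E) (h r : ℝ) (hh : 0 < h) (hr : 0 < r)
    (y : E) (hy : y ∈ subSphere W c h) (t h1 : ℝ) (ht : t * h ^ 2 = h ^ 2 - r ^ 2 / 2)
    (hh1 : 0 ≤ h1) (hh1' : h1 ^ 2 = h ^ 2 * (1 - t ^ 2)) (x : E) :
    (x ∈ subSphere W c h ∧ dist x y = r) ↔
      x ∈ subSphere ((Submodule.span ℝ {y - c})ᗮ ⊓ W) (c + t • (y - c)) h1 := by
  obtain ⟨hyW, hyn⟩ := hy
  have e1 : x - (c + t • (y - c)) = (x - c) - t • (y - c) := by abel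
  have e2 : dist x y = ‖(x - c) - (y - c)‖ := by rw [dist_eq_norm]; congr 1; abel
  simp only [subSphere, Set.mem_ofPred_eq, e1, e2, Submodule.mem_inf,
    Submodule.mem_orthogonal_singleton_iff_inner_right]
  generalize x - c = u at *
  generalize y - c = w at *
  have n1 : ‖u - w‖ ^ 2 = ‖u‖ ^ 2 - 2 * inner ℝ u w + ‖w‖ ^ 2 := norm_sub_sq_real u w
  have n2 : ‖u - t • w‖ ^ 2 = ‖u‖ ^ 2 - 2 * (t * inner ℝ u w) + t ^ 2 * ‖w‖ ^ 2 := by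
    rw [norm_sub_sq_real, inner_smul_right, norm_smul, mul_pow, Real.norm_eq_abs, sq_abs]
  have n3 : inner ℝ w (u - t • w) = inner ℝ u w - t * ‖w‖ ^ 2 := by
    rw [inner_sub_right, inner_smul_right, real_inner_self_eq_norm_sq, real_inner_comm]
  have hW : u ∈ W ↔ u - t • w ∈ W := by
    have := W.smul_mem t hyW
    exact (Submodule.sub_mem_iff_left W this).symm
  rw [← hW, n3]
  rw [hyn] at n1 n2 ⊢
  constructor
  · rintro ⟨⟨hu, hun⟩, hd⟩
    rw [hun, hd] at n1
    rw [hun] at n2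
    have hin : inner ℝ u w = t * h ^ 2 := by linarith
    refine ⟨⟨by linarith, hu⟩, ?_⟩
    rw [hin] at n2
    have : ‖u - t • w‖ ^ 2 = h1 ^ 2 := by rw [n2, hh1']; ring
    exact (sq_eq_sq₀ (norm_nonneg _) hh1).1 this
  · rintro ⟨⟨hin, hu⟩, hd⟩
    have hin : inner ℝ u w = t * h ^ 2 := by linarith
    rw [hd, hin, hh1'] at n2
    have hun : ‖u‖ = h := (sq_eq_sq₀ (norm_nonneg _) hh.le).1 (by linarith)
    refine ⟨⟨hu, hun⟩, ?_⟩
    rw [hun, hin] at n1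
    exact (sq_eq_sq₀ (norm_nonneg _) hr.le).1 (by linarith)

lemma subSphere_preconnected (W : Submodule ℝ E) (hW : 2 ≤ Module.finrank ℝ W) (c : E) (h : ℝ) :
    IsPreconnected (subSphere W c h) := by
  have hrk : 1 < Module.rank ℝ W := by
    rw [← Module.finrank_eq_rank]
    exact_mod_cast hW
  have h1 := isPreconnected_sphere hrk (0 : W) h
  have h2 := h1.image (fun w : W => c + (w : E)) (by fun_prop)
  convert h2 using 1
  ext x
  simp only [subSphere, Set.mem_ofPred_eq, Set.mem_image, mem_sphere_iff_norm, sub_zero]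
  constructor
  · rintro ⟨a, b⟩
    exact ⟨⟨x - c, a⟩, b, by simp⟩
  · rintro ⟨w, hw, rfl⟩
    simpa using hw

/-- A nonempty preconnected part of a sphere closed under moving by distance `r` is everything. -/
lemma subSphere_fill (W : Submodule ℝ E) (hW : 2 ≤ Module.finrank ℝ W) (c : E) (h r : ℝ)
    (hh : 0 < h) (hr : 0 < r) (hhr : r ^ 2 / 2 < h ^ 2) (A : Set E) (hAS : A ⊆ subSphere W c h)
    (hAc : IsPreconnected A) (hAn : A.Nonempty)
    (hA : ∀ a ∈ A, ∀ b ∈ subSphere W c h, dist b a = r → b ∈ A) : subSphere W c h ⊆ A := by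
  have key : ∀ a ∈ A, ∀ p ∈ subSphere W c h, dist a p < r → p ∈ A := by
    intro a ha p hp hap
    by_contra hpA
    obtain ⟨haW, han⟩ := hAS ha
    have hh2 : 0 < h ^ 2 := by positivity
    obtain ⟨t, ht⟩ : ∃ t, t * h ^ 2 = h ^ 2 - r ^ 2 / 2 :=
      ⟨(h ^ 2 - r ^ 2 / 2) / h ^ 2, by field_simp⟩
    have ht0 : 0 < t := by
      by_contra hc
      nlinarith
    have ht1 : t < 1 := by
      by_contra hc
      nlinarith [pow_pos hr 2]
    have h1n : 0 ≤ h ^ 2 * (1 - t ^ 2) := by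
      apply mul_nonneg hh2.le
      nlinarith
    obtain ⟨e, heW, hep, hen, hev⟩ : ∃ e ∈ W, inner ℝ (a - c) e = 0 ∧
        ‖e‖ = √(h ^ 2 * (1 - t ^ 2)) ∧ inner ℝ e (p - c) ≤ 0 := by
      obtain ⟨e, heW, hep, hen⟩ := exists_perp W hW (a - c) haW _ (Real.sqrt_nonneg _)
      rcases le_total (inner ℝ e (p - c)) 0 with hs | hs
      · exact ⟨e, heW, hep, hen, hs⟩
      · refine ⟨-e, W.neg_mem heW, by simp [hep], by simpa using hen, by simpa using hs⟩
    have hq := (subSphere_slice W c h r hh hr a ⟨haW, han⟩ t _ ht (Real.sqrt_nonneg _)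
      (Real.sq_sqrt h1n) (c + t • (a - c) + e)).2 (by
        simp only [subSphere, Set.mem_ofPred_eq, add_sub_cancel_left]
        exact ⟨⟨Submodule.mem_orthogonal_singleton_iff_inner_right.2 hep, heW⟩, hen⟩)
    have hqA := hA a ha _ hq.1 hq.2
    have hfar : r ≤ dist (c + t • (a - c) + e) p := by
      have e2 : dist (c + t • (a - c) + e) p = ‖(t • (a - c) + e) - (p - c)‖ := by
        rw [dist_eq_norm]; congr 1; abel
      have hqn : ‖t • (a - c) + e‖ = h := by
        have := hq.1.2
        rwa [show c + t • (a - c) + e - c = t • (a - c) + e by abel] at this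
      have n1 := norm_sub_sq_real (t • (a - c) + e) (p - c)
      rw [hqn, hp.2, inner_add_left, real_inner_smul_left] at n1
      have cs := real_inner_le_norm (a - c) (p - c)
      rw [han, hp.2] at cs
      rw [e2]
      apply le_of_sq_le_sq _ (norm_nonneg _)
      nlinarith
    have hivt := hAc.intermediate_value ha hqA
      (f := fun x => dist x p) (by fun_prop)
    obtain ⟨x, hxA, hx⟩ := hivt ⟨hap.le, hfar⟩
    exact hpA (hA x hxA p hp (by rw [dist_comm]; exact hx))
  intro p hp
  by_contra hpA
  have hpre := subSphere_preconnected W hW c h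
  obtain ⟨a, ha⟩ := hAn
  obtain ⟨z, hzS, hz1, hz2⟩ := hpre (⋃ a ∈ A, Metric.ball a (r / 2))
    (⋃ q ∈ subSphere W c h \ A, Metric.ball q (r / 2))
    (isOpen_biUnion fun _ _ => Metric.isOpen_ball) (isOpen_biUnion fun _ _ => Metric.isOpen_ball)
    (by
      intro x hx
      by_cases hxA : x ∈ A
      · left
        exact Set.mem_biUnion hxA (Metric.mem_ball_self (by positivity))
      · right
        exact Set.mem_biUnion ⟨hx, hxA⟩ (Metric.mem_ball_self (by positivity)))
    ⟨a, hAS ha, Set.mem_biUnion ha (Metric.mem_ball_self (by positivity))⟩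
    ⟨p, hp, Set.mem_biUnion ⟨hp, hpA⟩ (Metric.mem_ball_self (by positivity))⟩
  simp only [Set.mem_iUnion, Metric.mem_ball, exists_prop] at hz1 hz2
  obtain ⟨b, hb, hzb⟩ := hz1
  obtain ⟨q, hq, hzq⟩ := hz2
  refine hq.2 (key b hb q hq.1 ?_)
  have := dist_triangle_left b q z
  linarith

lemma subSphere_onto (f : E → E) (hf : Continuous f) (hinj : Function.Injective f) (r : ℝ)
    (hr : 0 < r) (hpr : ∀ x y, dist x y = r → dist (f x) (f y) = r) (d : ℕ) :
    ∀ (W W' : Submodule ℝ E) (c c' : E) (h : ℝ), Module.finrank ℝ W = d + 1 →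
      Module.finrank ℝ W' = d + 1 → 0 < h → r ^ 2 / 2 < h ^ 2 →
      Set.MapsTo f (subSphere W c h) (subSphere W' c' h) →
      subSphere W' c' h ⊆ f '' subSphere W c h := by
  induction d with
  | zero =>
    intro W W' c c' h hW hW' hh hhr hm p hp
    obtain ⟨e, heW, hen⟩ := exists_norm_eq_of_finrank_pos W (by omega) h hh.le
    have m1 : c + e ∈ subSphere W c h := by simp [subSphere, heW, hen]
    have m2 : c - e ∈ subSphere W c h := by
      simp [subSphere, heW, hen]
    have hne : f (c + e) ≠ f (c - e) := by
      intro hc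
      have h1 := hinj hc
      have h2 : (2 : ℝ) • e = 0 := by
        rw [two_smul]
        have : (c + e) - (c - e) = 0 := sub_eq_zero.2 h1
        rw [← this]; abel
      have h3 : e = 0 := by simpa using h2
      rw [h3, norm_zero] at hen
      linarith
    have two : ∀ a ∈ subSphere W' c' h, ∀ b ∈ subSphere W' c' h, a = b ∨ a - c' = -(b - c') := by
      intro a ha b hb
      have hb0 : (⟨b - c', hb.1⟩ : W') ≠ 0 := by
        intro hc
        have : b - c' = 0 := congrArg Subtype.val hc
        have h2 := hb.2
        rw [this, norm_zero] at h2
        linarith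
      obtain ⟨k, hk⟩ := (finrank_eq_one_iff_of_nonzero' _ hb0).1 hW' ⟨a - c', ha.1⟩
      have hk' : k • (b - c') = a - c' := congrArg Subtype.val hk
      have hn := congrArg norm hk'
      rw [norm_smul, ha.2, hb.2, Real.norm_eq_abs] at hn
      have : |k| = 1 := by
        have : |k| * h = 1 * h := by linarith
        exact mul_right_cancel₀ hh.ne' this
      rcases eq_or_eq_neg_of_abs_eq this with rfl | rfl
      · left
        rw [one_smul] at hk'
        exact (sub_left_injective hk').symm
      · right
        rw [← hk']; simp
    rcases two p hp _ (hm m1) with h1 | h1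
    · exact ⟨_, m1, h1.symm⟩
    rcases two p hp _ (hm m2) with h2 | h2
    · exact ⟨_, m2, h2.symm⟩
    exact absurd (sub_left_injective (neg_injective (h1.symm.trans h2))) hne
  | succ d ih =>
    intro W W' c c' h hW hW' hh hhr hm
    have hh2 : 0 < h ^ 2 := by positivity
    obtain ⟨t, ht⟩ : ∃ t, t * h ^ 2 = h ^ 2 - r ^ 2 / 2 :=
      ⟨(h ^ 2 - r ^ 2 / 2) / h ^ 2, by field_simp⟩
    have ht0 : 0 < t := by
      by_contra hc
      nlinarith
    have ht1 : t < 1 := by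
      by_contra hc
      nlinarith [pow_pos hr 2]
    have h1n : r ^ 2 / 2 < h ^ 2 * (1 - t ^ 2) := by
      have : h ^ 2 * (1 - t ^ 2) = (r ^ 2 / 2) * (1 + t) := by
        have : h ^ 2 * (1 - t ^ 2) = (h ^ 2 - t * h ^ 2) * (1 + t) := by ring
        rw [this, ht]; ring
      rw [this]
      nlinarith [pow_pos hr 2]
    have h1p : 0 < h ^ 2 * (1 - t ^ 2) := lt_trans (by positivity) h1n
    have fr : ∀ (V : Submodule ℝ E) (k y : E), Module.finrank ℝ V = d + 1 + 1 →
        y ∈ subSphere V k h →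
        Module.finrank ℝ ((Submodule.span ℝ {y - k})ᗮ ⊓ V : Submodule ℝ E) = d + 1 := by
      intro V k y hV hy
      apply Submodule.finrank_add_inf_finrank_orthogonal'
      · simpa using hy.1
      · rw [finrank_span_singleton, hV]
        · omega
        · intro hc
          have h2 := hy.2
          rw [hc, norm_zero] at h2
          linarith
    apply subSphere_fill W' (by omega) c' h r hh hr hhr _ hm.image_subset
    · exact (subSphere_preconnected W (by omega) c h).image f hf.continuousOn
    · obtain ⟨e, heW, hen⟩ := exists_norm_eq_of_finrank_pos W (by omega) h hh.le
      exact ⟨f (c + e), c + e, by simp [subSphere, heW, hen], rfl⟩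
    · rintro _ ⟨y, hy, rfl⟩ b hb hd
      have s1 := subSphere_slice W c h r hh hr y hy t _ ht (Real.sqrt_nonneg _)
        (Real.sq_sqrt h1p.le)
      have s2 := subSphere_slice W' c' h r hh hr (f y) (hm hy) t _ ht (Real.sqrt_nonneg _)
        (Real.sq_sqrt h1p.le)
      have := ih _ _ _ _ _ (fr W c y hW hy) (fr W' c' (f y) hW' (hm hy))
        (Real.sqrt_pos.2 h1p) (by rw [Real.sq_sqrt h1p.le]; exact h1n)
        (by
          intro x hx
          have hx' := (s1 x).2 hx
          exact (s2 (f x)).1 ⟨hm hx'.1, hpr _ _ hx'.2⟩)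
      obtain ⟨x, hx, rfl⟩ := this ((s2 b).1 ⟨hb, hd⟩)
      exact ⟨x, ((s1 x).2 hx).1, rfl⟩

lemma exists_common (hE : 2 ≤ Module.finrank ℝ E) (x y : E) (r : ℝ) (hr : 0 < r)
    (hxy : dist x y ≤ 2 * r) : ∃ z, dist x z = r ∧ dist z y = r := by
  have hn : 0 ≤ r ^ 2 - (dist x y / 2) ^ 2 := by
    nlinarith [dist_nonneg (x := x) (y := y)]
  obtain ⟨e, -, hep, hen⟩ := exists_perp (⊤ : Submodule ℝ E) (by simpa using hE)
    ((1 / 2 : ℝ) • (x - y)) trivial _ (Real.sqrt_nonneg (r ^ 2 - (dist x y / 2) ^ 2))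
  have hu : ‖(1 / 2 : ℝ) • (x - y)‖ = dist x y / 2 := by
    rw [norm_smul, dist_eq_norm]; norm_num; ring
  have hy : y = x - (1 / 2 : ℝ) • (x - y) - (1 / 2 : ℝ) • (x - y) := by
    rw [sub_sub, ← add_smul]; norm_num
  generalize (1 / 2 : ℝ) • (x - y) = u at *
  have hs := Real.sq_sqrt hn
  rw [← hen] at hs
  refine ⟨x - u + e, ?_, ?_⟩
  · rw [dist_eq_norm, show x - (x - u + e) = u - e by abel]
    apply (sq_eq_sq₀ (norm_nonneg _) hr.le).1
    rw [norm_sub_sq_real, hep, hu, hs]; ring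
  · have : dist (x - u + e) y = ‖u + e‖ := by
      conv_lhs => rw [hy]
      rw [dist_eq_norm]; congr 1; abel
    rw [this]
    apply (sq_eq_sq₀ (norm_nonneg _) hr.le).1
    rw [norm_add_sq_real, hep, hu, hs]; ring

lemma exists_ray [Nontrivial E] (x y : E) (a : ℝ) (ha : 0 ≤ a) :
    ∃ z, dist y z = a ∧ dist x z = dist x y + a := by
  by_cases h : x = y
  · subst h
    obtain ⟨e, he⟩ := exists_norm_eq E ha
    exact ⟨x + e, by simp [dist_eq_norm, he], by simp [dist_eq_norm, he]⟩
  · have hd : 0 < dist x y := dist_pos.2 h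
    refine ⟨y + (a / dist x y) • (y - x), ?_, ?_⟩
    · rw [dist_eq_norm, sub_add_cancel_left, norm_neg, norm_smul, ← dist_eq_norm y x,
        dist_comm y x, Real.norm_of_nonneg (by positivity)]
      field_simp
    · rw [dist_comm, dist_eq_norm,
        show y + (a / dist x y) • (y - x) - x = (1 + a / dist x y) • (y - x) by
          rw [add_smul, one_smul]; abel,
        norm_smul, ← dist_eq_norm y x,
        dist_comm y x, Real.norm_of_nonneg (by positivity)]
      field_simp

lemma surj_of_continuous (hE : 2 ≤ Module.finrank ℝ E) (f : E → E) (hf : Continuous f) (r : ℝ)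
    (hr : 0 < r) (hpr : ∀ x y, dist x y = r ↔ dist (f x) (f y) = r) : Function.Surjective f := by
  have : Nontrivial E := Module.nontrivial_of_finrank_pos (R := ℝ) (by omega)
  have hinj : Function.Injective f := by
    intro x y hxy
    obtain ⟨z, hz1, hz2⟩ := exists_ray x y r hr.le
    have h1 := (hpr y z).1 hz1
    rw [← hxy] at h1
    have h2 := (hpr x z).2 h1
    exact dist_le_zero.1 (by linarith)
  have hs : ∀ x b, dist b (f x) = r → ∃ z, f z = b := by
    intro x b hb
    obtain ⟨d, hd⟩ : ∃ d, Module.finrank ℝ E = d + 1 := ⟨Module.finrank ℝ E - 1, by omega⟩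
    have := subSphere_onto f hf hinj r hr (fun x y => (hpr x y).1) d ⊤ ⊤ x (f x) r
      (by simpa using hd) (by simpa using hd) hr (by nlinarith [pow_pos hr 2])
      (by
        rintro z ⟨-, hz⟩
        refine ⟨trivial, ?_⟩
        rw [← dist_eq_norm] at hz ⊢
        exact (hpr _ _).1 hz)
    obtain ⟨z, -, hz⟩ := this ⟨trivial, by rwa [← dist_eq_norm]⟩
    exact ⟨z, hz⟩
  have hs2 : ∀ a ∈ Set.range f, ∀ b, dist a b ≤ 2 * r → b ∈ Set.range f := by
    rintro _ ⟨x, rfl⟩ b hb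
    obtain ⟨z, hz1, hz2⟩ := exists_common hE (f x) b r hr hb
    obtain ⟨w, rfl⟩ := hs x z (by rwa [dist_comm])
    exact hs w b (by rwa [dist_comm])
  have hcl : IsClopen (Set.range f) := by
    constructor
    · rw [← isOpen_compl_iff, Metric.isOpen_iff]
      intro p hp
      refine ⟨r, hr, fun q hq hqr => hp (hs2 q hqr p ?_)⟩
      have := Metric.mem_ball.1 hq
      linarith
    · rw [Metric.isOpen_iff]
      intro p hp
      refine ⟨r, hr, fun q hq => hs2 p hp q ?_⟩
      have := Metric.mem_ball'.1 hq
      linarith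
  exact Set.range_eq_univ.1 (hcl.eq_univ (Set.range_nonempty f))

lemma isometry_of_surj (hE : 2 ≤ Module.finrank ℝ E) (f : E → E) (hf : Function.Surjective f)
    (r R : ℝ) (hr : 0 < r) (hR : 0 < R)
    (hpr : ∀ x y, dist x y = r ↔ dist (f x) (f y) = r)
    (hpR : ∀ x y, dist x y = R ↔ dist (f x) (f y) = R)
    (hirr : Irrational (r / R)) (x y : E) : dist (f x) (f y) = dist x y := by
  have : Nontrivial E := Module.nontrivial_of_finrank_pos (R := ℝ) (by omega)
  let Q : ℝ → Prop := fun t => ∀ x y, dist x y ≤ t ↔ dist (f x) (f y) ≤ t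
  have hQ2 : ∀ s, 0 < s → (∀ x y, dist x y = s ↔ dist (f x) (f y) = s) → Q (2 * s) := by
    intro s hs hps x y
    constructor
    · intro h
      obtain ⟨z, h1, h2⟩ := exists_common hE x y s hs h
      have := dist_triangle (f x) (f z) (f y)
      rw [(hps _ _).1 h1, (hps _ _).1 h2] at this
      linarith
    · intro h
      obtain ⟨z, h1, h2⟩ := exists_common hE (f x) (f y) s hs h
      obtain ⟨z, rfl⟩ := hf z
      have := dist_triangle x z y
      rw [(hps _ _).2 h1, (hps _ _).2 h2] at this
      linarith
  have hadd : ∀ a b, 0 ≤ a → 0 ≤ b → Q a → Q b → Q (a + b) := by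
    intro a b ha hb hqa hqb x y
    constructor
    · intro h
      obtain ⟨z, h1, h2⟩ := exists_dist_le_le hb ha h
      have := dist_triangle (f x) (f z) (f y)
      have := (hqb _ _).1 h1
      have := (hqa _ _).1 h2
      linarith
    · intro h
      obtain ⟨z, h1, h2⟩ := exists_dist_le_le hb ha h
      obtain ⟨z, rfl⟩ := hf z
      have := dist_triangle x z y
      have := (hqb _ _).2 h1
      have := (hqa _ _).2 h2
      linarith
  have hsub : ∀ a b, 0 ≤ a → a ≤ b → Q a → Q b → Q (b - a) := by
    intro a b ha hab hqa hqb x y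
    constructor
    · intro h
      obtain ⟨z, h1, h2⟩ := exists_ray (f x) (f y) a ha
      obtain ⟨z, rfl⟩ := hf z
      have h3 := (hqa y z).2 h1.le
      have h4 := (hqb x z).1 (by linarith [dist_triangle x y z])
      linarith
    · intro h
      obtain ⟨z, h1, h2⟩ := exists_ray x y a ha
      have h3 := (hqa y z).1 h1.le
      have h4 := (hqb x z).2 (by linarith [dist_triangle (f x) (f y) (f z)])
      linarith
  have hQr := hQ2 r hr hpr
  have hQR := hQ2 R hR hpR
  let H : AddSubgroup ℝ :=
    { carrier := {t | Q |t|}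
      zero_mem' := by
        have := hsub _ _ (by positivity) le_rfl hQr hQr
        simpa using this
      add_mem' := by
        intro a b ha hb
        simp only [Set.mem_ofPred_eq] at ha hb ⊢
        have h1 := hadd _ _ (abs_nonneg a) (abs_nonneg b) ha hb
        have h2 := hsub |a| |b| (abs_nonneg a)
        have h3 := hsub |b| |a| (abs_nonneg b)
        have : |a + b| = |a| + |b| ∨ (|a| ≤ |b| ∧ |a + b| = |b| - |a|) ∨
            (|b| ≤ |a| ∧ |a + b| = |a| - |b|) := by
          rcases abs_cases a with h | h <;> rcases abs_cases b with h' | h' <;>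
            rcases abs_cases (a + b) with h'' | h'' <;> grind
        rcases this with h | ⟨h, h'⟩ | ⟨h, h'⟩
        · rwa [h]
        · rw [h']; exact h2 h ha hb
        · rw [h']; exact h3 h hb ha
      neg_mem' := by
        intro a ha
        simpa using ha }
  have hd : Dense (H : Set ℝ) := by
    have h1 : Irrational ((2 * r) / (2 * R)) := by
      rwa [mul_div_mul_left _ _ two_ne_zero]
    refine (dense_addSubgroupClosure_pair_iff.2 h1).mono ?_
    have : AddSubgroup.closure {2 * r, 2 * R} ≤ H := by
      rw [AddSubgroup.closure_le]
      rintro t (rfl | rfl)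
      · change Q |2 * r|
        rwa [abs_of_pos (by positivity)]
      · change Q |2 * R|
        rwa [abs_of_pos (by positivity)]
    exact this
  have hH : ∀ t ∈ H, 0 ≤ t → Q t := by
    intro t ht h0
    have : Q |t| := ht
    rwa [abs_of_nonneg h0] at this
  rcases lt_trichotomy (dist (f x) (f y)) (dist x y) with h | h | h
  · obtain ⟨t, ht, h1, h2⟩ := hd.exists_between h
    have := (hH t ht (dist_nonneg.trans h1.le) x y).2 h1.le
    linarith
  · exact h
  · obtain ⟨t, ht, h1, h2⟩ := hd.exists_between h
    have := (hH t ht (dist_nonneg.trans h1.le) x y).1 h1.le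
    linarith

end Helpers

theorem stmt_0 (n : ℕ) (hn : 2 ≤ n)
    (f : EuclideanSpace ℝ (Fin n) → EuclideanSpace ℝ (Fin n))
    (hf : Function.Surjective f ∨ Continuous f)
    (r R : ℝ) (hr : 0 < r) (hR : 0 < R)
    (hpr : ∀ x y, dist x y = r ↔ dist (f x) (f y) = r)
    (hpR : ∀ x y, dist x y = R ↔ dist (f x) (f y) = R)
    (hirr : Irrational (r / R)) :
    Function.Bijective f ∧ ∀ x y, dist (f x) (f y) = dist x y := by
  have hE : 2 ≤ Module.finrank ℝ (EuclideanSpace ℝ (Fin n)) := by simpa using hn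
  have hs : Function.Surjective f := by
    rcases hf with hf | hf
    · exact hf
    · exact surj_of_continuous hE f hf r hr hpr
  have hi := isometry_of_surj hE f hs r R hr hR hpr hpR hirr
  refine ⟨⟨fun x y hxy => ?_, hs⟩, hi⟩
  have := hi x y
  rw [hxy, dist_self] at this
  exact dist_eq_zero.1 this.symm
end

section
/- Let n ≥ 2 and let f : E^n → E^n be a function that is surjective or continuous. If there exists r > 0 that is strongly preserved by f, then f is a surjective isometry, i.e. f is a bijection and d(f(x), f(y)) = d(x, y) for all x, y ∈ E^n. (This is the Euclidean-space instance of Theorem B; Euclidean space is a connected two-point homogeneous space with infinite convexity radius.) -/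
namespace BQ

/-- `f` preserves the distance `r`. -/
def Pres {E : Type*} [MetricSpace E] (f : E → E) (r : ℝ) : Prop :=
  0 < r ∧ ∀ x y, dist x y = r → dist (f x) (f y) = r

variable {E : Type*} [NormedAddCommGroup E] [InnerProductSpace ℝ E]

theorem exists_perp (h2 : 2 ≤ Module.finrank ℝ E) (v : E) :
    ∃ w : E, ‖w‖ = 1 ∧ inner ℝ v w = 0 := by
  have : FiniteDimensional ℝ E := Module.finite_of_finrank_pos (by omega)
  have h1 := Submodule.finrank_add_finrank_orthogonal (Submodule.span ℝ {v})
  have h3 : Module.finrank ℝ (Submodule.span ℝ {v}) ≤ 1 := by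
    simpa using finrank_span_le_card (R := ℝ) ({v} : Set E)
  have hb : (Submodule.span ℝ {v})ᗮ ≠ ⊥ := by
    intro hb
    rw [hb] at h1
    simp at h1
    omega
  obtain ⟨w, hw, hw0⟩ := Submodule.exists_mem_ne_zero_of_ne_bot hb
  refine ⟨(‖w‖⁻¹ : ℝ) • w, ?_, ?_⟩
  · rw [norm_smul, norm_inv, norm_norm, inv_mul_cancel₀ (norm_ne_zero_iff.2 hw0)]
  · rw [inner_smul_right, Submodule.mem_orthogonal_singleton_iff_inner_right.1 hw, mul_zero]

theorem isosceles (h2 : 2 ≤ Module.finrank ℝ E) (x y : E) (e : ℝ) (h : dist x y ≤ 2 * e) :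
    ∃ z, dist x z = e ∧ dist z y = e := by
  obtain ⟨w, hw, hvw⟩ := exists_perp h2 (x - y)
  have he : 0 ≤ e := by linarith [dist_nonneg (x := x) (y := y)]
  rw [dist_eq_norm] at h
  set d := ‖x - y‖ with hd
  have hd0 : 0 ≤ d := norm_nonneg _
  have hs : 0 ≤ e ^ 2 - d ^ 2 / 4 := by nlinarith
  set s := Real.sqrt (e ^ 2 - d ^ 2 / 4) with hsd
  have hs2 : s ^ 2 = e ^ 2 - d ^ 2 / 4 := Real.sq_sqrt hs
  refine ⟨y + (1 / 2 : ℝ) • (x - y) + s • w, ?_, ?_⟩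
  · rw [dist_eq_norm]
    have : x - (y + (1 / 2 : ℝ) • (x - y) + s • w) = (1 / 2 : ℝ) • (x - y) - s • w := by module
    rw [this]
    refine (sq_eq_sq₀ (norm_nonneg _) he).1 ?_
    rw [norm_sub_sq_real, norm_smul, norm_smul, inner_smul_left, inner_smul_right, hvw, hw, ← hd,
      mul_pow, mul_pow, Real.norm_eq_abs, Real.norm_eq_abs, sq_abs, sq_abs, hs2]
    simp; ring
  · rw [dist_eq_norm]
    have : (y + (1 / 2 : ℝ) • (x - y) + s • w) - y = (1 / 2 : ℝ) • (x - y) + s • w := by module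
    rw [this]
    refine (sq_eq_sq₀ (norm_nonneg _) he).1 ?_
    rw [norm_add_sq_real, norm_smul, norm_smul, inner_smul_left, inner_smul_right, hvw, hw, ← hd,
      mul_pow, mul_pow, Real.norm_eq_abs, Real.norm_eq_abs, sq_abs, sq_abs, hs2]
    simp; ring

theorem injective_of_strong (h2 : 2 ≤ Module.finrank ℝ E) (f : E → E) (r : ℝ) (hr : 0 < r)
    (hpr : ∀ x y, dist x y = r ↔ dist (f x) (f y) = r) : Function.Injective f := by
  intro x y hxy
  by_contra hne
  have hd : 0 < ‖x - y‖ := norm_pos_iff.2 (sub_ne_zero.2 hne)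
  set z := x + (r / ‖x - y‖) • (x - y) with hz
  have h1 : dist z x = r := by
    rw [dist_eq_norm, hz, add_sub_cancel_left, norm_smul, Real.norm_eq_abs,
      abs_of_pos (by positivity)]
    field_simp
  have h3 : dist z y = r + ‖x - y‖ := by
    have : z - y = (r / ‖x - y‖ + 1) • (x - y) := by rw [hz]; module
    rw [dist_eq_norm, this, norm_smul, Real.norm_eq_abs, abs_of_pos (by positivity)]
    field_simp
  have h4 := (hpr z y).2 (by rw [← hxy]; exact (hpr z x).1 h1)
  linarith

theorem chain (h2 : 2 ≤ Module.finrank ℝ E) (f : E → E) (e : ℝ) (he : Pres f e) (m : ℕ) :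
    ∀ x y, dist x y ≤ (m + 2) * e → dist (f x) (f y) ≤ (m + 2) * e := by
  obtain ⟨he0, he⟩ := he
  induction m with
  | zero =>
    intro x y h
    simp only [Nat.cast_zero, zero_add] at h ⊢
    obtain ⟨z, hz1, hz2⟩ := isosceles h2 x y e h
    have := dist_triangle (f x) (f z) (f y)
    rw [he _ _ hz1, he _ _ hz2] at this
    linarith
  | succ m ih =>
    intro x y h
    push_cast at h ⊢
    by_cases hc : dist x y ≤ (m + 2) * e
    · have := ih x y hc
      linarith
    · push Not at hc
      rw [dist_eq_norm] at hc h
      have hme : (0 : ℝ) ≤ m * e := by positivity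
      have hd : e < ‖x - y‖ := by nlinarith
      have hd0 : 0 < ‖x - y‖ := by linarith
      set z := x + (e / ‖x - y‖) • (y - x) with hz
      have h1 : dist x z = e := by
        rw [dist_comm, dist_eq_norm, hz, add_sub_cancel_left, norm_smul, Real.norm_eq_abs,
          abs_of_pos (by positivity), norm_sub_rev y x]
        field_simp
      have h3 : dist z y = ‖x - y‖ - e := by
        have : z - y = (1 - e / ‖x - y‖) • (x - y) := by rw [hz]; module
        have hle : e / ‖x - y‖ < 1 := by rw [div_lt_one hd0]; exact hd
        rw [dist_eq_norm, this, norm_smul, Real.norm_eq_abs, abs_of_pos (by linarith)]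
        field_simp
      have h4 := ih z y (by rw [h3]; linarith)
      have := dist_triangle (f x) (f z) (f y)
      rw [he _ _ h1] at this
      linarith

theorem isometry_of_scales (h2 : 2 ≤ Module.finrank ℝ E) (f : E → E)
    (hsmall : ∀ e > 0, ∃ d, d < e ∧ Pres f d) (hlarge : ∀ t, ∃ d, t < d ∧ Pres f d) (x y : E) :
    dist (f x) (f y) = dist x y := by
  have hlip : ∀ x y, dist (f x) (f y) ≤ dist x y := by
    intro x y
    refine le_of_forall_pos_le_add fun e he => ?_
    obtain ⟨d, hd, hp⟩ := hsmall (e / 2) (by linarith)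
    have hd0 := hp.1
    have h1 : dist x y / d < ⌊dist x y / d⌋₊ + 1 := Nat.lt_floor_add_one _
    have h3 : (⌊dist x y / d⌋₊ : ℝ) ≤ dist x y / d := Nat.floor_le (by positivity)
    rw [div_lt_iff₀ hd0] at h1
    rw [le_div_iff₀ hd0] at h3
    have := chain h2 f d hp _ x y (by linarith : _ ≤ ((⌊dist x y / d⌋₊ : ℝ) + 2) * d)
    linarith
  refine le_antisymm (hlip x y) ?_
  rcases eq_or_ne x y with rfl | hne
  · simp
  have hd0 : 0 < ‖x - y‖ := norm_pos_iff.2 (sub_ne_zero.2 hne)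
  obtain ⟨d, hd, hp⟩ := hlarge (dist x y)
  rw [dist_eq_norm] at hd
  set z := x + (d / ‖x - y‖) • (y - x) with hz
  have h1 : dist x z = d := by
    have := hp.1
    rw [dist_comm, dist_eq_norm, hz, add_sub_cancel_left, norm_smul, Real.norm_eq_abs,
      abs_of_pos (by positivity), norm_sub_rev y x]
    field_simp
  have h3 : dist y z = d - ‖x - y‖ := by
    have : y - z = (d / ‖x - y‖ - 1) • (x - y) := by rw [hz]; module
    have hle : 1 < d / ‖x - y‖ := by rw [one_lt_div hd0]; exact hd
    rw [dist_eq_norm, this, norm_smul, Real.norm_eq_abs, abs_of_pos (by linarith)]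
    field_simp
  have h4 := hlip y z
  have h5 := dist_triangle (f x) (f y) (f z)
  rw [hp.2 _ _ h1] at h5
  rw [dist_eq_norm x y]
  linarith

/-- `n` points forming a regular simplex with side `β`, at distance `α` from both `x`, `y`. -/
theorem exists_simplex {n : ℕ} (hn : 0 < n) (hE : Module.finrank ℝ E = n) {α β γ : ℝ}
    (hα : 0 < α) (hβ : 0 < β) (hγ : 0 < γ)
    (h : γ ^ 2 = 4 * α ^ 2 - 2 * β ^ 2 * (n - 1) / n) (x y : E) (hxy : dist x y = γ) :
    ∃ p : Fin n → E, (∀ i j, i ≠ j → dist (p i) (p j) = β) ∧ (∀ i, dist x (p i) = α) ∧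
      ∀ i, dist y (p i) = α := by
  have : FiniteDimensional ℝ E := Module.finite_of_finrank_pos (by omega)
  have hn' : (0 : ℝ) < n := by exact_mod_cast hn
  let e : OrthonormalBasis (Fin n) ℝ E :=
    (stdOrthonormalBasis ℝ E).reindex (finCongr hE)
  have sumnorm : ∀ b : OrthonormalBasis (Fin n) ℝ E, ‖∑ i, b i‖ ^ 2 = n := by
    intro b
    rw [← real_inner_self_eq_norm_sq, sum_inner]
    simp [inner_sum, b.inner_eq_ite]
  set k := Real.sqrt n with hk
  have hk0 : 0 < k := Real.sqrt_pos.2 hn'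
  have hk2 : k ^ 2 = n := Real.sq_sqrt hn'.le
  set g := γ / k with hg
  have hg2 : g ^ 2 * n = γ ^ 2 := by rw [hg, ← hk2]; field_simp
  have hb : ∃ b : OrthonormalBasis (Fin n) ℝ E, x - y = g • ∑ i, b i := by
    have hnorm : ‖g • ∑ i, e i‖ = ‖x - y‖ := by
      rw [← dist_eq_norm x y, hxy]
      refine (sq_eq_sq₀ (norm_nonneg _) hγ.le).1 ?_
      rw [norm_smul, mul_pow, sumnorm, Real.norm_eq_abs, sq_abs, hg2]
    have hR := Submodule.reflection_sub hnorm
    refine ⟨e.map ((ℝ ∙ (g • ∑ i, e i - (x - y)))ᗮ.reflection), ?_⟩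
    refine hR.symm.trans ?_
    simp only [map_smul, map_sum, OrthonormalBasis.map_apply]
  obtain ⟨b, hb⟩ := hb
  set S := ∑ i, b i with hS
  have hbS : ∀ i, inner ℝ S (b i) = 1 := by
    intro i
    rw [hS, sum_inner]
    simp [b.inner_eq_ite]
  set μ := β / Real.sqrt 2 with hμ
  have hμ2 : 2 * μ ^ 2 = β ^ 2 := by
    rw [hμ, div_pow, Real.sq_sqrt (by norm_num)]; ring
  have key : ∀ (l : ℝ) i, ‖l • S - μ • b i‖ ^ 2 = l ^ 2 * n - 2 * l * μ + μ ^ 2 := by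
    intro l i
    rw [norm_sub_sq_real, norm_smul, norm_smul, inner_smul_left, inner_smul_right, hbS,
      mul_pow, mul_pow, sumnorm, b.norm_eq_one, Real.norm_eq_abs, Real.norm_eq_abs, sq_abs, sq_abs]
    simp; ring
  have hα2 : α ^ 2 = g ^ 2 * n / 4 + μ ^ 2 * (n - 1) / n := by
    rw [hg2, h, ← hμ2]; ring
  refine ⟨fun i => y + (1 / 2 : ℝ) • (x - y) + μ • (b i - (1 / n : ℝ) • S), ?_, ?_, ?_⟩
  · intro i j hij
    rw [dist_eq_norm]
    have : (y + (1 / 2 : ℝ) • (x - y) + μ • (b i - (1 / n : ℝ) • S)) -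
      (y + (1 / 2 : ℝ) • (x - y) + μ • (b j - (1 / n : ℝ) • S)) = μ • (b i - b j) := by module
    rw [this]
    refine (sq_eq_sq₀ (norm_nonneg _) hβ.le).1 ?_
    rw [norm_smul, mul_pow, norm_sub_sq_real, b.norm_eq_one, b.norm_eq_one,
      b.inner_eq_zero hij, Real.norm_eq_abs, sq_abs, ← hμ2]
    ring
  · intro i
    rw [dist_eq_norm]
    have : x - (y + (1 / 2 : ℝ) • (x - y) + μ • (b i - (1 / n : ℝ) • S)) =
        (g / 2 + μ / n) • S - μ • b i := by
      have : x = y + g • S := by rw [← hb]; abel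
      rw [hb, this]; module
    rw [this]
    refine (sq_eq_sq₀ (norm_nonneg _) hα.le).1 ?_
    rw [key, hα2]
    field_simp
    ring
  · intro i
    rw [dist_eq_norm]
    have : y - (y + (1 / 2 : ℝ) • (x - y) + μ • (b i - (1 / n : ℝ) • S)) =
        (-g / 2 + μ / n) • S - μ • b i := by
      rw [hb]; module
    rw [this]
    refine (sq_eq_sq₀ (norm_nonneg _) hα.le).1 ?_
    rw [key, hα2]
    field_simp
    ring

theorem rigid {n : ℕ} (hn : 0 < n) (hE : Module.finrank ℝ E = n) {α β γ : ℝ}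
    (hβ : 0 < β) (hγ : 0 < γ)
    (h : γ ^ 2 = 4 * α ^ 2 - 2 * β ^ 2 * (n - 1) / n) (x y : E) (hne : x ≠ y)
    (p : Fin n → E) (hp : ∀ i j, i ≠ j → dist (p i) (p j) = β) (hx : ∀ i, dist x (p i) = α)
    (hy : ∀ i, dist y (p i) = α) : dist x y = γ := by
  have hn' : (0 : ℝ) < n := by exact_mod_cast hn
  haveI : Nonempty (Fin n) := ⟨⟨0, hn⟩⟩
  let q : Fin n → E := fun i => p i - x
  set κ := α ^ 2 - β ^ 2 / 2 with hκ
  have hγn : β ^ 2 / 2 + n * κ = n * γ ^ 2 / 4 := by rw [h, hκ]; field_simp; ring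
  have hq : ∀ i, ‖q i‖ = α := fun i => by rw [← hx i, dist_comm, dist_eq_norm]
  have hgram : ∀ i j, inner ℝ (q i) (q j) = (if i = j then β ^ 2 / 2 else 0) + κ := by
    intro i j
    split_ifs with hij
    · subst hij
      rw [real_inner_self_eq_norm_sq, hq, hκ]; ring
    · have h1 := norm_sub_sq_real (q i) (q j)
      have h3 : q i - q j = p i - p j := by simp [q]
      rw [h3, ← dist_eq_norm, hp i j hij, hq, hq] at h1
      rw [hκ]; linarith
  have hin : ∀ (c : Fin n → ℝ) i, inner ℝ (q i) (∑ j, c j • q j) =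
      β ^ 2 / 2 * c i + κ * ∑ j, c j := by
    intro c i
    rw [inner_sum]
    simp only [inner_smul_right, hgram, mul_add, Finset.sum_add_distrib]
    simp [← Finset.sum_mul, mul_comm]
  have hli : LinearIndependent ℝ q := by
    rw [Fintype.linearIndependent_iff]
    intro c hc
    have h1 : ∀ i, β ^ 2 / 2 * c i + κ * ∑ j, c j = 0 := by
      intro i; rw [← hin, hc, inner_zero_right]
    have h3 : (β ^ 2 / 2 + n * κ) * ∑ j, c j = 0 := by
      have := Finset.sum_congr (rfl : (Finset.univ : Finset (Fin n)) = Finset.univ)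
        (fun i _ => h1 i)
      rw [Finset.sum_add_distrib, ← Finset.mul_sum] at this
      simp at this
      linarith
    rw [hγn] at h3
    have h4 : ∑ j, c j = 0 := by
      rcases mul_eq_zero.1 h3 with h5 | h5
      · have : 0 < n * γ ^ 2 / 4 := by positivity
        linarith
      · exact h5
    intro i
    have h5 := h1 i
    rw [h4, mul_zero, add_zero] at h5
    rcases mul_eq_zero.1 h5 with h6 | h6
    · have : 0 < β ^ 2 / 2 := by positivity
      linarith
    · exact h6
  let B := basisOfLinearIndependentOfCardEqFinrank hli (by simp [hE])
  set c := B.repr (y - x) with hc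
  have hyc : y - x = ∑ i, c i • q i := by
    have := B.sum_repr (y - x)
    simp only [B, coe_basisOfLinearIndependentOfCardEqFinrank] at this
    exact this.symm
  have hiy : ∀ i, 2 * inner ℝ (q i) (y - x) = ‖y - x‖ ^ 2 := by
    intro i
    have h1 := norm_sub_sq_real (q i) (y - x)
    have h3 : q i - (y - x) = p i - y := by simp [q]
    rw [h3, ← dist_eq_norm, dist_comm, hy, hq] at h1
    linarith
  let i0 : Fin n := ⟨0, hn⟩
  have hce : ∀ i, c i = c i0 := by
    intro i
    have h1 := hiy i
    have h3 := hiy i0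
    rw [hyc, hin] at h1 h3
    have h4 : β ^ 2 * (c i - c i0) = 0 := by linarith
    rcases mul_eq_zero.1 h4 with h6 | h6
    · have : 0 < β ^ 2 := by positivity
      linarith
    · linarith
  set t := c i0 with ht
  have hsum : ∑ j, c j = n * t := by simp [hce]
  have hi : ∀ i, inner ℝ (q i) (y - x) = t * (n * γ ^ 2 / 4) := by
    intro i
    rw [hyc, hin, hsum, hce, ← hγn]; ring
  have hnn : ‖y - x‖ ^ 2 = n * t * (t * (n * γ ^ 2 / 4)) := by
    rw [← real_inner_self_eq_norm_sq]
    nth_rewrite 1 [hyc]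
    rw [sum_inner]
    simp only [inner_smul_left, hi, hce]
    simp; ring
  have h1 := hiy i0
  rw [hi] at h1
  have hpos : 0 < ‖y - x‖ := norm_pos_iff.2 (sub_ne_zero.2 hne.symm)
  have ht0 : t ≠ 0 := by
    intro h0
    rw [h0] at hnn
    simp at hnn
    exact hne (sub_eq_zero.1 hnn).symm
  have hnt : n * t = 2 := by
    have h3 : (t * (n * γ ^ 2 / 4)) * (n * t - 2) = 0 := by linarith
    rcases mul_eq_zero.1 h3 with h6 | h6
    · exact absurd h6 (mul_ne_zero ht0 (by positivity))
    · linarith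
  rw [dist_comm, dist_eq_norm]
  refine (sq_eq_sq₀ (norm_nonneg _) hγ.le).1 ?_
  rw [hnn]
  have : n * t * (t * (n * γ ^ 2 / 4)) = (n * t) * (n * t) * γ ^ 2 / 4 := by ring
  rw [this, hnt]; ring

theorem Pres.gamma {n : ℕ} (hn : 0 < n) (hE : Module.finrank ℝ E = n) {f : E → E}
    (hf : Function.Injective f) {α β γ : ℝ} (hα : Pres f α) (hβ : Pres f β) (hγ : 0 < γ)
    (h : γ ^ 2 = 4 * α ^ 2 - 2 * β ^ 2 * (n - 1) / n) : Pres f γ := by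
  refine ⟨hγ, fun x y hxy => ?_⟩
  obtain ⟨p, h1, h3, h4⟩ := exists_simplex hn hE hα.1 hβ.1 hγ h x y hxy
  refine rigid hn hE hβ.1 hγ h _ _ (fun he => ?_) (fun i => f (p i))
    (fun i j hij => hβ.2 _ _ (h1 i j hij)) (fun i => hα.2 _ _ (h3 i)) (fun i => hα.2 _ _ (h4 i))
  rw [hf he, dist_self] at hxy
  exact hγ.ne hxy

/-- Straight triples from distances `r` and `√3 r`. -/
theorem Pres.two_mul (h2 : 2 ≤ Module.finrank ℝ E) {f : E → E} {r : ℝ} (hr : Pres f r)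
    (hr3 : Pres f (Real.sqrt 3 * r)) : Pres f (2 * r) := by
  obtain ⟨r0, hr⟩ := hr
  obtain ⟨-, hr3⟩ := hr3
  refine ⟨by linarith, fun x y hxy => ?_⟩
  have hs3 : Real.sqrt 3 ^ 2 = 3 := Real.sq_sqrt (by norm_num)
  obtain ⟨w, hw, hvw⟩ := exists_perp h2 (y - x)
  set u := (1 / 2 : ℝ) • (y - x) with hu
  have hun : ‖u‖ = r := by
    rw [hu, norm_smul, ← dist_eq_norm, dist_comm, hxy]
    norm_num
    ring
  have huw : inner ℝ u w = 0 := by rw [hu, inner_smul_left, hvw, mul_zero]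
  have hy : y = x + (2 : ℝ) • u := by rw [hu]; module
  clear_value u
  have comb : ∀ a b : ℝ, ∀ z z' : E, z - z' = a • u + (b * r) • w →
      dist z z' ^ 2 = (a ^ 2 + b ^ 2) * r ^ 2 := by
    intro a b z z' hz
    rw [dist_eq_norm, hz, norm_add_sq_real, norm_smul, norm_smul, inner_smul_left,
      inner_smul_right, huw, hw, hun, mul_pow, mul_pow, Real.norm_eq_abs, Real.norm_eq_abs,
      sq_abs, sq_abs]
    simp; ring
  have c1 : ∀ a b : ℝ, ∀ z z' : E, z - z' = a • u + (b * r) • w → a ^ 2 + b ^ 2 = 1 →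
      dist (f z) (f z') ^ 2 = r ^ 2 := by
    intro a b z z' hz hab
    rw [hr z z']
    refine (sq_eq_sq₀ dist_nonneg r0.le).1 ?_
    rw [comb a b z z' hz, hab, one_mul]
  have c3 : ∀ a b : ℝ, ∀ z z' : E, z - z' = a • u + (b * r) • w → a ^ 2 + b ^ 2 = 3 →
      dist (f z) (f z') ^ 2 = 3 * r ^ 2 := by
    intro a b z z' hz hab
    rw [hr3 z z', mul_pow, hs3]
    refine (sq_eq_sq₀ dist_nonneg (by positivity)).1 ?_
    rw [comb a b z z' hz, hab, mul_pow, hs3]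
  set s := Real.sqrt 3 / 2 with hs
  have hss : s ^ 2 = 3 / 4 := by rw [hs, div_pow, hs3]; norm_num
  set m := x + u with hm
  set p := x + (1 / 2 : ℝ) • u + (s * r) • w with hp
  set q := x + (3 / 2 : ℝ) • u + (s * r) • w with hq
  have e1 := c1 (-1) 0 x m (by rw [hm]; module) (by norm_num)
  have e2 := c1 1 0 y m (by rw [hm, hy]; module) (by norm_num)
  have e3 := c1 (-1/2) s p m (by rw [hm, hp]; module) (by rw [hss]; norm_num)
  have e4 := c1 (1/2) s q m (by rw [hm, hq]; module) (by rw [hss]; norm_num)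
  have e5 := c1 (-1) 0 p q (by rw [hp, hq]; module) (by norm_num)
  have e6 := c1 (-1/2) (-s) x p (by rw [hp]; module) (by rw [neg_sq, hss]; norm_num)
  have e7 := c1 (1/2) (-s) y q (by rw [hq, hy]; module) (by rw [neg_sq, hss]; norm_num)
  have e8 := c3 (-3/2) (-s) x q (by rw [hq]; module) (by rw [neg_sq, hss]; norm_num)
  have e9 := c3 (3/2) (-s) y p (by rw [hp, hy]; module) (by rw [neg_sq, hss]; norm_num)
  rw [dist_eq_norm] at e1 e2 e3 e4 e5 e6 e7 e8 e9
  obtain ⟨X, hX⟩ : ∃ X, X = f x - f m := ⟨_, rfl⟩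
  obtain ⟨Y, hY⟩ : ∃ X, X = f y - f m := ⟨_, rfl⟩
  obtain ⟨P, hP⟩ : ∃ X, X = f p - f m := ⟨_, rfl⟩
  obtain ⟨Q, hQ⟩ : ∃ X, X = f q - f m := ⟨_, rfl⟩
  have sb : ∀ a b : E, a - b = (a - f m) - (b - f m) := fun a b => by abel
  rw [sb, ← hP, ← hQ, norm_sub_sq_real, hP, hQ, e3, e4, ← hP, ← hQ] at e5
  rw [sb, ← hX, ← hP, norm_sub_sq_real, hX, hP, e1, e3, ← hX, ← hP] at e6
  rw [sb, ← hY, ← hQ, norm_sub_sq_real, hY, hQ, e2, e4, ← hY, ← hQ] at e7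
  rw [sb, ← hX, ← hQ, norm_sub_sq_real, hX, hQ, e1, e4, ← hX, ← hQ] at e8
  rw [sb, ← hY, ← hP, norm_sub_sq_real, hY, hP, e2, e3, ← hY, ← hP] at e9
  rw [← hX] at e1
  rw [← hY] at e2
  rw [← hP] at e3
  rw [← hQ] at e4
  have z1 : X - (P - Q) = 0 := by
    rw [← norm_eq_zero, ← sq_eq_zero_iff, norm_sub_sq_real, norm_sub_sq_real, inner_sub_right]
    linarith
  have z2 : Y - (Q - P) = 0 := by
    rw [← norm_eq_zero, ← sq_eq_zero_iff, norm_sub_sq_real, norm_sub_sq_real, inner_sub_right,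
      real_inner_comm P Q]
    linarith
  have hXY : f x - f y = (2 : ℝ) • X := by
    rw [sb, ← hX, ← hY, sub_eq_zero.1 z1, sub_eq_zero.1 z2]; module
  rw [dist_eq_norm, hXY, norm_smul, (sq_eq_sq₀ (norm_nonneg _) r0.le).1 e1]
  norm_num

theorem mid_of {a b c : E} {r : ℝ} (h1 : dist a b = r) (h3 : dist b c = r)
    (h4 : dist a c = 2 * r) : c - a = (2 : ℝ) • (b - a) := by
  rw [dist_comm, dist_eq_norm] at h1 h3 h4
  have e : c - b = (c - a) - (b - a) := by abel
  have h5 := norm_sub_sq_real (c - a) (b - a)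
  rw [← e, h1, h3, h4] at h5
  rw [← sub_eq_zero, ← norm_eq_zero, ← sq_eq_zero_iff, norm_sub_sq_real, norm_smul,
    inner_smul_right, h1, h4]
  norm_num
  linarith

theorem Pres.half (h2 : 2 ≤ Module.finrank ℝ E) {f : E → E} {r : ℝ} (hr : Pres f r)
    (hr2 : Pres f (2 * r)) : Pres f (r / 2) := by
  obtain ⟨r0, hr⟩ := hr
  obtain ⟨-, hr2⟩ := hr2
  refine ⟨by linarith, fun x y hxy => ?_⟩
  obtain ⟨a, ha1, ha2⟩ := isosceles h2 x y r (by linarith)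
  rw [dist_comm] at ha1
  have main : ∀ z, dist a z = r → f (a + (2 : ℝ) • (z - a)) - f a = (2 : ℝ) • (f z - f a) := by
    intro z hz
    refine mid_of (hr _ _ hz) (hr _ _ ?_) (hr2 _ _ ?_)
    · rw [← hz, dist_eq_norm, dist_eq_norm]; congr 1; module
    · rw [← hz, dist_comm, dist_comm a z, dist_eq_norm, dist_eq_norm, add_sub_cancel_left,
        norm_smul]
      norm_num
  have hx := main x ha1
  have hy := main y ha2
  have h3 : dist (a + (2 : ℝ) • (x - a)) (a + (2 : ℝ) • (y - a)) = r := by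
    have : (a + (2 : ℝ) • (x - a)) - (a + (2 : ℝ) • (y - a)) = (2 : ℝ) • (x - y) := by module
    rw [dist_eq_norm, this, norm_smul, ← dist_eq_norm, hxy]
    norm_num
    ring
  have h4 := hr _ _ h3
  have h5 : f (a + (2 : ℝ) • (x - a)) - f (a + (2 : ℝ) • (y - a)) = (2 : ℝ) • (f x - f y) := by
    rw [← sub_sub_sub_cancel_right _ _ (f a), hx, hy]; module
  rw [dist_eq_norm, h5, norm_smul, ← dist_eq_norm] at h4
  norm_num at h4
  linarith

theorem main {n : ℕ} (hn : 2 ≤ n) (hE : Module.finrank ℝ E = n) {f : E → E}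
    (hf : Function.Injective f) {r : ℝ} (hr : Pres f r) (x y : E) :
    dist (f x) (f y) = dist x y := by
  have h2 : 2 ≤ Module.finrank ℝ E := by omega
  have hn' : (2 : ℝ) ≤ n := by exact_mod_cast hn
  have hs : Real.sqrt (2 * (n + 1) / n) ^ 2 = 2 * (n + 1) / n := Real.sq_sqrt (by positivity)
  set h := Real.sqrt (2 * (n + 1) / n) with hh
  have h1 : 1 < h := by
    rw [hh, Real.lt_sqrt (by norm_num), lt_div_iff₀ (by linarith)]; linarith
  have up : ∀ r, Pres f r → Pres f (h * r) := by
    intro r hr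
    have := hr.1
    refine Pres.gamma (by omega) hE hf hr hr (by positivity) ?_
    rw [mul_pow, hs]
    field_simp
    ring
  have down : ∃ q : ℝ, 0 < q ∧ q < 1 ∧ ∀ r, Pres f r → Pres f (q * r) := by
    rcases hn.eq_or_lt with h0 | h0
    · refine ⟨1 / 2, by norm_num, by norm_num, fun r hr => ?_⟩
      have h3 : h = Real.sqrt 3 := by rw [hh, ← h0]; norm_num
      have := Pres.half h2 hr (Pres.two_mul h2 hr (h3 ▸ up r hr))
      convert this using 1; ring
    · have hn3 : (3 : ℝ) ≤ n := by exact_mod_cast h0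
      refine ⟨2 / n, by positivity, by rw [div_lt_one (by linarith)]; linarith, fun r hr => ?_⟩
      have := hr.1
      refine Pres.gamma (by omega) hE hf hr (up r hr) (by positivity) ?_
      rw [mul_pow, mul_pow, hs]
      field_simp
      ring
  obtain ⟨q, hq0, hq1, down⟩ := down
  have r0 := hr.1
  have downk : ∀ k : ℕ, Pres f (q ^ k * r) := by
    intro k
    induction k with
    | zero => simpa using hr
    | succ k ih => rw [pow_succ', mul_assoc]; exact down _ ih
  have upk : ∀ k : ℕ, Pres f (h ^ k * r) := by
    intro k
    induction k with
    | zero => simpa using hr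
    | succ k ih => rw [pow_succ', mul_assoc]; exact up _ ih
  refine isometry_of_scales h2 f ?_ ?_ x y
  · intro e he
    obtain ⟨k, hk⟩ := exists_pow_lt_of_lt_one (show 0 < e / r by positivity) hq1
    exact ⟨_, (lt_div_iff₀ r0).1 hk, downk k⟩
  · intro t
    obtain ⟨k, hk⟩ := pow_unbounded_of_one_lt (t / r) h1
    exact ⟨_, (div_lt_iff₀ r0).1 hk, upk k⟩

end BQ

theorem stmt_1 (n : ℕ) (hn : 2 ≤ n)
    (f : EuclideanSpace ℝ (Fin n) → EuclideanSpace ℝ (Fin n))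
    (hf : Function.Surjective f ∨ Continuous f)
    (r : ℝ) (hr : 0 < r)
    (hpr : ∀ x y, dist x y = r ↔ dist (f x) (f y) = r) :
    Function.Bijective f ∧ ∀ x y, dist (f x) (f y) = dist x y := by
  have hE : Module.finrank ℝ (EuclideanSpace ℝ (Fin n)) = n := by simp
  have hinj := BQ.injective_of_strong (by rw [hE]; exact hn) f r hr hpr
  have hd := BQ.main hn hE hinj ⟨hr, fun x y => (hpr x y).1⟩
  refine ⟨⟨hinj, ?_⟩, hd⟩
  have hi : Isometry f := Isometry.of_dist_eq hd
  have hs := (hi.affineIsometryOfStrictConvexSpace.toAffineIsometryEquiv rfl).surjective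
  simpa using hs
end
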